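/- Let J₀(x) = (1/π)∫₀^π cos(x sin θ) dθ and J₁(x) = (1/π)∫₀^π cos(θ − x sin θ) dθ. Let f : (0, ∞) → ℝ be twice continuously differentiable, and let p > 0. Assume that r·f(r) and r·f'(r) tend to 0 as r → 0⁺ and as r → ∞, and that the functions r ↦ (f''(r) + f'(r)/r)·J₀(p r)·r and r ↦ f(r)·J₀(p r)·r are Lebesgue integrable on (0, ∞). Then ∫₀^∞ (f''(r) + f'(r)/r)·J₀(p r)·r dr = −p²·∫₀^∞ f(r)·J₀(p r)·r dr. -/

import Mathlib

open Real MeasureTheory Filter Topology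

noncomputable def J0 (x : ℝ) : ℝ := (1 / π) * ∫ θ in (0:ℝ)..π, Real.cos (x * Real.sin θ)

noncomputable def J1 (x : ℝ) : ℝ := (1 / π) * ∫ θ in (0:ℝ)..π, Real.cos (θ - x * Real.sin θ)

/-- Differentiation under the integral sign when the derivative of the integrand is bounded. -/
theorem hasDerivAt_intervalIntegral_of_bounded_deriv {F F' : ℝ → ℝ → ℝ} {a b C x : ℝ}
    (hF : ∀ y, Continuous (F y)) (hF' : ∀ y, Continuous (F' y))
    (hC : ∀ y θ, ‖F' y θ‖ ≤ C) (hd : ∀ y θ, HasDerivAt (fun z => F z θ) (F' y θ) y) :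
    HasDerivAt (fun y => ∫ θ in a..b, F y θ) (∫ θ in a..b, F' x θ) x :=
  (intervalIntegral.hasDerivAt_integral_of_dominated_loc_of_deriv_le (bound := fun _ => C)
    univ_mem (Eventually.of_forall fun y => (hF y).aestronglyMeasurable)
    ((hF x).intervalIntegrable a b) (hF' x).aestronglyMeasurable
    (ae_of_all _ fun θ _ y _ => hC y θ) intervalIntegrable_const
    (ae_of_all _ fun θ _ y _ => hd y θ)).2

/-- The negative of the derivative of `J0`. -/
noncomputable def negDerivJ0 (x : ℝ) : ℝ :=
  (1 / π) * ∫ θ in (0:ℝ)..π, Real.sin θ * Real.sin (x * Real.sin θ)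

theorem hasDerivAt_J0 (x : ℝ) : HasDerivAt J0 (-negDerivJ0 x) x := by
  have h := (hasDerivAt_intervalIntegral_of_bounded_deriv (a := 0) (b := π) (C := 1) (x := x)
    (F := fun y θ => cos (y * sin θ)) (F' := fun y θ => -(sin θ * sin (y * sin θ)))
    (fun y => by fun_prop) (fun y => by fun_prop)
    (fun y θ => by
      rw [norm_neg, norm_mul]
      exact mul_le_one₀ (abs_sin_le_one _) (norm_nonneg _) (abs_sin_le_one _))
    (fun y θ => by
      refine (hasDerivAt_mul_const (x := y) (sin θ)).cos.congr_deriv ?_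
      ring)).const_mul (1 / π)
  rw [intervalIntegral.integral_neg, mul_neg] at h
  exact h

theorem hasDerivAt_negDerivJ0 (x : ℝ) :
    HasDerivAt negDerivJ0 ((1 / π) * ∫ θ in (0:ℝ)..π, sin θ ^ 2 * cos (x * sin θ)) x :=
  (hasDerivAt_intervalIntegral_of_bounded_deriv (a := 0) (b := π) (C := 1) (x := x)
    (F := fun y θ => sin θ * sin (y * sin θ)) (F' := fun y θ => sin θ ^ 2 * cos (y * sin θ))
    (fun y => by fun_prop) (fun y => by fun_prop)
    (fun y θ => by
      rw [norm_mul, norm_pow]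
      exact mul_le_one₀ (pow_le_one₀ (norm_nonneg _) (abs_sin_le_one _)) (norm_nonneg _)
        (abs_cos_le_one _))
    (fun y θ => by
      refine ((hasDerivAt_mul_const (x := y) (sin θ)).sin.const_mul (sin θ)).congr_deriv ?_
      ring)).const_mul (1 / π)

/-- Bessel's equation of order zero, in the divergence form `(x J₁(x))' = x J₀(x)`. -/
theorem hasDerivAt_mul_negDerivJ0 (x : ℝ) :
    HasDerivAt (fun y => y * negDerivJ0 y) (x * J0 x) x := by
  refine ((hasDerivAt_id' x).fun_mul (hasDerivAt_negDerivJ0 x)).congr_deriv ?_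
  have key : ∫ θ in (0:ℝ)..π, (x * cos (x * sin θ) - sin θ * sin (x * sin θ)
      - x * (sin θ ^ 2 * cos (x * sin θ))) = 0 := by
    rw [intervalIntegral.integral_eq_sub_of_hasDerivAt (f := fun θ => cos θ * sin (x * sin θ))
      (fun θ _ => ?_) (Continuous.intervalIntegrable (by fun_prop) _ _)]
    · simp
    · refine ((hasDerivAt_cos θ).fun_mul ((hasDerivAt_sin θ).const_mul x).sin).congr_deriv ?_
      linear_combination (x * cos (x * sin θ)) * sin_sq_add_cos_sq θ
  rw [intervalIntegral.integral_sub (Continuous.intervalIntegrable (by fun_prop) _ _)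
      (Continuous.intervalIntegrable (by fun_prop) _ _),
    intervalIntegral.integral_sub (Continuous.intervalIntegrable (by fun_prop) _ _)
      (Continuous.intervalIntegrable (by fun_prop) _ _),
    intervalIntegral.integral_const_mul, intervalIntegral.integral_const_mul] at key
  simp only [J0, negDerivJ0]
  linear_combination (-1 / π) * key

theorem abs_one_div_pi_mul_intervalIntegral_le_one {g : ℝ → ℝ} (hg : ∀ θ, |g θ| ≤ 1) :
    |(1 / π) * ∫ θ in (0:ℝ)..π, g θ| ≤ 1 := by
  have h := intervalIntegral.norm_integral_le_of_norm_le_const (a := 0) (b := π) (f := g)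
    (C := 1) fun θ _ => hg θ
  rw [sub_zero, abs_of_pos pi_pos, one_mul, norm_eq_abs] at h
  rw [abs_mul, abs_of_pos (by positivity : 0 < 1 / π), one_div_mul_eq_div]
  exact (div_le_one pi_pos).2 h

theorem abs_J0_le_one (x : ℝ) : |J0 x| ≤ 1 :=
  abs_one_div_pi_mul_intervalIntegral_le_one fun _ => abs_cos_le_one _

theorem abs_negDerivJ0_le_one (x : ℝ) : |negDerivJ0 x| ≤ 1 :=
  abs_one_div_pi_mul_intervalIntegral_le_one fun θ => by
    rw [abs_mul]
    exact mul_le_one₀ (abs_sin_le_one _) (abs_nonneg _) (abs_sin_le_one _)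

theorem hankel_laplacian_J0 (f : ℝ → ℝ) (p : ℝ) (hp : 0 < p)
    (hf : ContDiffOn ℝ 2 f (Set.Ioi 0))
    (h0 : Tendsto (fun r => r * f r) (𝓝[>] 0) (𝓝 0))
    (h0D : Tendsto (fun r => r * deriv f r) (𝓝[>] 0) (𝓝 0))
    (hInf : Tendsto (fun r => r * f r) atTop (𝓝 0))
    (hInfD : Tendsto (fun r => r * deriv f r) atTop (𝓝 0))
    (hint1 : IntegrableOn
      (fun r => (deriv (deriv f) r + deriv f r / r) * J0 (p * r) * r) (Set.Ioi 0))
    (hint2 : IntegrableOn (fun r => f r * J0 (p * r) * r) (Set.Ioi 0)) :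
    ∫ r in Set.Ioi (0:ℝ), (deriv (deriv f) r + deriv f r / r) * J0 (p * r) * r =
      -p ^ 2 * ∫ r in Set.Ioi (0:ℝ), f r * J0 (p * r) * r := by
  set W : ℝ → ℝ := fun r =>
    r * deriv f r * J0 (p * r) + f r * (p * r * negDerivJ0 (p * r)) with hW
  have tendsto_W {l : Filter ℝ} (h : Tendsto (fun r => r * f r) l (𝓝 0))
      (hD : Tendsto (fun r => r * deriv f r) l (𝓝 0)) : Tendsto W l (𝓝 0) := by
    have h1 := hD.zero_mul_isBoundedUnder_le (g := fun r => J0 (p * r))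
      (isBoundedUnder_of ⟨1, fun r => abs_J0_le_one _⟩)
    have h2 := h.zero_mul_isBoundedUnder_le (g := fun r => negDerivJ0 (p * r))
      (isBoundedUnder_of ⟨1, fun r => abs_negDerivJ0_le_one _⟩)
    have h3 := h1.add (h2.const_mul p)
    rw [mul_zero, add_zero] at h3
    refine h3.congr fun r => ?_
    simp only [hW]
    ring
  have hcont : ContinuousWithinAt W (Set.Ici 0) 0 := by
    rw [← continuousWithinAt_Ioi_iff_Ici, ContinuousWithinAt]
    simpa [hW] using tendsto_W h0 h0D
  have hderiv : ∀ r ∈ Set.Ioi (0:ℝ), HasDerivAt W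
      ((deriv (deriv f) r + deriv f r / r) * J0 (p * r) * r
        + p ^ 2 * (f r * J0 (p * r) * r)) r := by
    intro r hr
    have hr0 : r ≠ 0 := (Set.mem_Ioi.1 hr).ne'
    have hnhds := Ioi_mem_nhds (Set.mem_Ioi.1 hr)
    have hf1 : HasDerivAt f (deriv f r) r :=
      ((hf.contDiffAt hnhds).differentiableAt (by norm_num)).hasDerivAt
    have hf2 : HasDerivAt (deriv f) (deriv (deriv f) r) r :=
      (((hf.deriv_of_isOpen (m := 1) isOpen_Ioi (by norm_num)).contDiffAt hnhds).differentiableAt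
        (by norm_num)).hasDerivAt
    have hlin : HasDerivAt (fun r : ℝ => p * r) p r := by
      simpa using (hasDerivAt_id' r).const_mul p
    have h1 := ((hasDerivAt_id' r).fun_mul hf2).fun_mul ((hasDerivAt_J0 (p * r)).comp r hlin)
    have h2 := hf1.fun_mul ((hasDerivAt_mul_negDerivJ0 (p * r)).comp r hlin)
    refine (h1.fun_add h2).congr_deriv ?_
    simp only [Function.comp_apply]
    field_simp
    ring
  have h := integral_Ioi_of_hasDerivAt_of_tendsto hcont hderiv
    (hint1.add (hint2.const_mul (p ^ 2))) (tendsto_W hInf hInfD)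
  rw [integral_add hint1 (hint2.const_mul (p ^ 2)), integral_const_mul] at h
  simp only [hW, zero_mul, mul_zero, add_zero, sub_zero] at h
  linear_combination h
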